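/- arXiv:1504.01946 — 2 statements merged into one kernel-verified Lean document; each statement's English description precedes it below -/
import Mathlib

section
/- For all n, m ∈ ℕ the following identities of linear operators on the space of functions ℤ → ℂ hold, where H_{n,m} := (n+m+1)·M∘M + D∘X∘M − (n+1)·id: (1) L_{n+m+1} ∘ M = H_{n,m} + (n+1)·id; (2) M ∘ L_{n+m} = H_{n,m} + n·id; (3) G_{n+m+1} ∘ (−D) = −H_{n,m} + (m+1)·id; (4) (−D) ∘ G_{n+m} = −H_{n,m} + m·id. Consequently on ker H_{n,m} the four narrow circuit endomorphisms L_{n+m+1}∘M, M∘L_{n+m}, G_{n+m+1}∘(−D), (−D)∘G_{n+m} act as the scalars n+1, n, m+1, m respectively. -/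
/-- The mix operator `(M f)(x) = (f(x+1) + f(x−1))/2` on functions `ℤ → ℂ`. -/
noncomputable def Mop : Module.End ℂ (ℤ → ℂ) where
  toFun f := fun x => (f (x + 1) + f (x - 1)) / 2
  map_add' f g := by funext x; simp [Pi.add_apply]; ring
  map_smul' c f := by funext x; simp [Pi.smul_apply, smul_eq_mul]; ring

/-- The symmetric difference operator `(D f)(x) = (f(x+1) − f(x−1))/2` on `ℤ → ℂ`. -/
noncomputable def Dop : Module.End ℂ (ℤ → ℂ) where
  toFun f := fun x => (f (x + 1) - f (x - 1)) / 2
  map_add' f g := by funext x; simp [Pi.add_apply]; ring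
  map_smul' c f := by funext x; simp [Pi.smul_apply, smul_eq_mul]; ring

/-- The multiplication operator `(X f)(x) = x·f(x)` on `ℤ → ℂ`. -/
noncomputable def Xop : Module.End ℂ (ℤ → ℂ) where
  toFun f := fun x => (x : ℂ) * f x
  map_add' f g := by funext x; simp [Pi.add_apply]; ring
  map_smul' c f := by funext x; simp [Pi.smul_apply, smul_eq_mul]; ring

/-- `G_j := j·D + M∘X`. -/
noncomputable def Gop (j : ℤ) : Module.End ℂ (ℤ → ℂ) := (j : ℂ) • Dop + Mop * Xop

/-- `L_j := j·M + D∘X`. -/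
noncomputable def Lop (j : ℤ) : Module.End ℂ (ℤ → ℂ) := (j : ℂ) • Mop + Dop * Xop

/-- The binomial operator `H_{n,m} := (n+m+1)·M∘M + D∘X∘M − (n+1)·id`. -/
noncomputable def Hbin (n m : ℕ) : Module.End ℂ (ℤ → ℂ) :=
  ((n : ℂ) + (m : ℂ) + 1) • (Mop * Mop) + Dop * Xop * Mop - ((n : ℂ) + 1) • 1

/-- The hyperbolic identity `M² = D² + 1`. -/
theorem Mop_mul_Mop : Mop * Mop = Dop * Dop + 1 := by
  ext1 f
  funext x
  simp [Mop, Dop]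
  ring

theorem Mop_mul_Dop : Mop * Dop = Dop * Mop := by
  ext1 f
  funext x
  simp [Mop, Dop]
  ring

/-- The commutation relation `[M, X] = D`. -/
theorem Xop_mul_Mop : Xop * Mop = Mop * Xop - Dop := by
  ext1 f
  funext x
  simp [Mop, Dop, Xop]
  ring

/-- The commutation relation `[D, X] = M`. -/
theorem Xop_mul_Dop : Xop * Dop = Dop * Xop - Mop := by
  ext1 f
  funext x
  simp [Mop, Dop, Xop]
  ring

theorem Lop_mul_Mop (n m : ℕ) :
    Lop ((n : ℤ) + (m : ℤ) + 1) * Mop = Hbin n m + ((n : ℂ) + 1) • 1 := by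
  simp only [Lop, Hbin, add_mul, smul_mul_assoc]
  push_cast
  module

theorem Mop_mul_Lop (n m : ℕ) :
    Mop * Lop ((n : ℤ) + (m : ℤ)) = Hbin n m + (n : ℂ) • 1 := by
  simp only [Lop, Hbin, mul_add, mul_smul_comm, mul_assoc, Xop_mul_Mop, mul_sub, Mop_mul_Mop]
  rw [← mul_assoc Mop, Mop_mul_Dop, mul_assoc]
  push_cast
  module

theorem Gop_mul_neg_Dop (n m : ℕ) :
    Gop ((n : ℤ) + (m : ℤ) + 1) * (-Dop) = -(Hbin n m) + ((m : ℂ) + 1) • 1 := by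
  refine (LinearMap.comp_neg Dop (Gop _)).trans ?_
  rw [← Module.End.mul_eq_comp]
  simp only [Gop, Hbin, add_mul, smul_mul_assoc, mul_assoc, Xop_mul_Mop, Xop_mul_Dop,
    mul_sub, Mop_mul_Mop]
  rw [← mul_assoc Mop, Mop_mul_Dop, mul_assoc]
  push_cast
  module

theorem neg_Dop_mul_Gop (n m : ℕ) :
    (-Dop) * Gop ((n : ℤ) + (m : ℤ)) = -(Hbin n m) + (m : ℂ) • 1 := by
  refine (LinearMap.neg_comp (Gop _) Dop).trans ?_
  rw [← Module.End.mul_eq_comp]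
  simp only [Gop, Hbin, mul_add, mul_smul_comm, mul_assoc, Xop_mul_Mop, mul_sub,
    Mop_mul_Mop]
  push_cast
  module

/-- The four narrow circuit identities of the binomial grid, and the resulting scalar
actions `n+1`, `n`, `m+1`, `m` of the four narrow circuit endomorphisms on
`ker H_{n,m}`. -/
theorem binomial_grid_circuits (n m : ℕ) :
    (Lop ((n : ℤ) + (m : ℤ) + 1) * Mop = Hbin n m + ((n : ℂ) + 1) • 1)
    ∧ (Mop * Lop ((n : ℤ) + (m : ℤ)) = Hbin n m + (n : ℂ) • 1)
    ∧ (Gop ((n : ℤ) + (m : ℤ) + 1) * (-Dop) = -(Hbin n m) + ((m : ℂ) + 1) • 1)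
    ∧ ((-Dop) * Gop ((n : ℤ) + (m : ℤ)) = -(Hbin n m) + (m : ℂ) • 1)
    ∧ (∀ f ∈ LinearMap.ker (Hbin n m),
        (Lop ((n : ℤ) + (m : ℤ) + 1) * Mop) f = ((n : ℂ) + 1) • f
        ∧ (Mop * Lop ((n : ℤ) + (m : ℤ))) f = (n : ℂ) • f
        ∧ (Gop ((n : ℤ) + (m : ℤ) + 1) * (-Dop)) f = ((m : ℂ) + 1) • f
        ∧ ((-Dop) * Gop ((n : ℤ) + (m : ℤ))) f = (m : ℂ) • f) := by
  refine ⟨Lop_mul_Mop n m, Mop_mul_Lop n m, Gop_mul_neg_Dop n m, neg_Dop_mul_Gop n m,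
    fun f hf => ?_⟩
  rw [LinearMap.mem_ker] at hf
  rw [Lop_mul_Mop, Mop_mul_Lop, Gop_mul_neg_Dop, neg_Dop_mul_Gop]
  simp only [LinearMap.add_apply, LinearMap.neg_apply, LinearMap.smul_apply, Module.End.one_apply,
    hf, neg_zero, zero_add, and_self]
end

section
/- Let δ₀ : ℤ → ℂ be the function with δ₀(0) = 1 and δ₀(x) = 0 for x ≠ 0. Then: (1) for every j ∈ ℤ the operator identity L_{j−1}∘L_j − G_{j−1}∘G_j = j²·id − X∘X holds on functions ℤ → ℂ; (2) for every n ∈ ℕ, G_n(Mⁿ δ₀) = 0, and for every m ∈ ℕ, L_m(Dᵐ δ₀) = 0; (3) consequently, for every n ≥ 1, L_{n−1}(L_n(Mⁿ δ₀)) = (n²·id − X∘X)(Mⁿ δ₀), and for every m ≥ 1, G_{m−1}(G_m(Dᵐ δ₀)) = (X∘X − m²·id)(Dᵐ δ₀). -/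
/-- The Kronecker delta `δ₀ : ℤ → ℂ`. -/
noncomputable def delta0 : ℤ → ℂ := fun x => if x = 0 then 1 else 0

theorem Dop_mul_Mop : Dop * Mop = Mop * Dop := by
  ext f x
  simp [Mop, Dop]
  ring

theorem Xop_delta0 : Xop delta0 = 0 := by
  funext x
  simp [Xop, delta0]

theorem Gop_mul_Mop (j : ℤ) : Gop (j + 1) * Mop = Mop * Gop j := by
  simp only [Gop, add_mul, mul_add, mul_assoc, Xop_mul_Mop, mul_sub, smul_mul_assoc,
    mul_smul_comm, Dop_mul_Mop]
  push_cast
  module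

theorem Lop_mul_Dop (j : ℤ) : Lop (j + 1) * Dop = Dop * Lop j := by
  simp only [Lop, add_mul, mul_add, mul_assoc, Xop_mul_Dop, mul_sub, smul_mul_assoc,
    mul_smul_comm, Dop_mul_Mop]
  push_cast
  module

theorem Lop_mul_Lop_sub_Gop_mul_Gop (j : ℤ) :
    Lop (j - 1) * Lop j - Gop (j - 1) * Gop j = ((j : ℂ) ^ 2) • 1 - Xop * Xop := by
  have hDXM : Dop * (Xop * Mop) = Mop * (Dop * Xop) - Dop * Dop := by
    rw [Xop_mul_Mop, mul_sub, ← mul_assoc, Dop_mul_Mop, mul_assoc]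
  have hMXD : Mop * (Xop * Dop) = Mop * (Dop * Xop) - (Dop * Dop + 1) := by
    rw [Xop_mul_Dop, mul_sub, Mop_mul_Mop]
  have hDXDX : Dop * (Xop * (Dop * Xop)) = Dop * (Dop * (Xop * Xop)) - Mop * (Dop * Xop) := by
    rw [← mul_assoc Xop, Xop_mul_Dop, sub_mul, mul_sub, mul_assoc Dop Xop, ← mul_assoc Dop Mop,
      Dop_mul_Mop, mul_assoc]
  have hMXMX : Mop * (Xop * (Mop * Xop)) =
      Dop * (Dop * (Xop * Xop)) + Xop * Xop - Mop * (Dop * Xop) := by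
    rw [← mul_assoc Xop, Xop_mul_Mop, sub_mul, mul_sub, mul_assoc Mop Xop, ← mul_assoc Mop Mop,
      Mop_mul_Mop, add_mul, one_mul, mul_assoc]
  have hDMX : Dop * (Mop * Xop) = Mop * (Dop * Xop) := by
    rw [← mul_assoc, Dop_mul_Mop, mul_assoc]
  simp only [Lop, Gop, add_mul, mul_add, mul_assoc, smul_mul_assoc, mul_smul_comm, hDXM, hMXD,
    hDXDX, hMXMX, hDMX, Mop_mul_Mop]
  push_cast
  module

theorem Gop_Mop_pow_delta0 (n : ℕ) : Gop (n : ℤ) ((Mop ^ n) delta0) = 0 := by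
  induction n with
  | zero => simp [Gop, Xop_delta0]
  | succ n ih =>
    rw [pow_succ', Module.End.mul_apply, ← Module.End.mul_apply, Nat.cast_succ, Gop_mul_Mop,
      Module.End.mul_apply, ih, map_zero]

theorem Lop_Dop_pow_delta0 (m : ℕ) : Lop (m : ℤ) ((Dop ^ m) delta0) = 0 := by
  induction m with
  | zero => simp [Lop, Xop_delta0]
  | succ m ih =>
    rw [pow_succ', Module.End.mul_apply, ← Module.End.mul_apply, Nat.cast_succ, Lop_mul_Dop,
      Module.End.mul_apply, ih, map_zero]

/-- (1) `L_{j−1}∘L_j − G_{j−1}∘G_j = j²·id − X∘X`; (2) `G_n(Mⁿ δ₀) = 0` and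
`L_m(Dᵐ δ₀) = 0`; (3) hence `L_{n−1}(L_n(Mⁿ δ₀)) = (n²·id − X∘X)(Mⁿ δ₀)` and
`G_{m−1}(G_m(Dᵐ δ₀)) = (X∘X − m²·id)(Dᵐ δ₀)`. -/
theorem binomial_ladder_identities :
    (∀ j : ℤ, Lop (j - 1) * Lop j - Gop (j - 1) * Gop j = ((j : ℂ) ^ 2) • 1 - Xop * Xop)
    ∧ (∀ n : ℕ, Gop (n : ℤ) ((Mop ^ n) delta0) = 0)
    ∧ (∀ m : ℕ, Lop (m : ℤ) ((Dop ^ m) delta0) = 0)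
    ∧ (∀ n : ℕ, 1 ≤ n →
        Lop ((n : ℤ) - 1) (Lop (n : ℤ) ((Mop ^ n) delta0))
          = (((n : ℂ) ^ 2) • 1 - Xop * Xop) ((Mop ^ n) delta0))
    ∧ (∀ m : ℕ, 1 ≤ m →
        Gop ((m : ℤ) - 1) (Gop (m : ℤ) ((Dop ^ m) delta0))
          = (Xop * Xop - ((m : ℂ) ^ 2) • 1) ((Dop ^ m) delta0)) := by
  refine ⟨Lop_mul_Lop_sub_Gop_mul_Gop, Gop_Mop_pow_delta0, Lop_Dop_pow_delta0,
    fun n _ => ?_, fun m _ => ?_⟩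
  · have h := LinearMap.congr_fun (Lop_mul_Lop_sub_Gop_mul_Gop n) ((Mop ^ n) delta0)
    rwa [LinearMap.sub_apply, Module.End.mul_apply, Module.End.mul_apply, Gop_Mop_pow_delta0,
      map_zero, sub_zero, Int.cast_natCast] at h
  · have h := LinearMap.congr_fun (Lop_mul_Lop_sub_Gop_mul_Gop m) ((Dop ^ m) delta0)
    rw [LinearMap.sub_apply, Module.End.mul_apply, Module.End.mul_apply, Lop_Dop_pow_delta0,
      map_zero, zero_sub, Int.cast_natCast] at h
    rw [← neg_sub (_ • _), LinearMap.neg_apply, ← h, neg_neg]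
end
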